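/- If 0 < θ < 1 and ρ ≥ 1, then I(t)/(r(t)Q(t)) → 1 and I(t) → 0 as t → ∞, and consequently P_t/(r(t)Q(t)) → 1, i.e. P{Y(t) > 0} ∼ r(t)Q(t) as t → ∞. -/

import Mathlib

open Filter MeasureTheory Set in
theorem intervalIntegrable_of_integrableOn_Ioc_zero {f : ℝ → ℝ}
    (hint : ∀ t > (0:ℝ), IntegrableOn f (Ioc 0 t)) {a b : ℝ} (ha : 0 ≤ a) (hb : 0 ≤ b) :
    IntervalIntegrable f volume a b := by
  have key : ∀ c : ℝ, 0 ≤ c → IntervalIntegrable f volume 0 c := by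
    intro c hc
    rcases hc.eq_or_lt with rfl | hc
    · exact IntervalIntegrable.refl
    · exact (intervalIntegrable_iff_integrableOn_Ioc_of_le hc.le).2 (hint c hc)
  exact (key a ha).symm.trans (key b hb)

open Filter MeasureTheory Set in
theorem AntitoneOn.integral_bounds {f : ℝ → ℝ} (hanti : AntitoneOn f (Ioi 0))
    (hint : ∀ t > (0:ℝ), IntegrableOn f (Ioc 0 t)) {a b : ℝ} (ha : 0 < a) (hab : a ≤ b) :
    (∫ u in (0:ℝ)..a, f u) + (b - a) * f b ≤ ∫ u in (0:ℝ)..b, f u ∧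
      ∫ u in (0:ℝ)..b, f u ≤ (∫ u in (0:ℝ)..a, f u) + (b - a) * f a := by
  have hi := intervalIntegrable_of_integrableOn_Ioc_zero hint ha.le (ha.le.trans hab)
  rw [← intervalIntegral.integral_add_adjacent_intervals
    (intervalIntegrable_of_integrableOn_Ioc_zero hint le_rfl ha.le) hi]
  have h1 : ∫ _u in a..b, f b ≤ ∫ u in a..b, f u :=
    intervalIntegral.integral_mono_on hab intervalIntegrable_const hi fun u hu =>
      hanti (ha.trans_le hu.1) (ha.trans_le hab) hu.2
  have h2 : ∫ u in a..b, f u ≤ ∫ _u in a..b, f a :=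
    intervalIntegral.integral_mono_on hab hi intervalIntegrable_const fun u hu =>
      hanti ha (ha.trans_le hu.1) hu.1
  simp only [intervalIntegral.integral_const, smul_eq_mul] at h1 h2
  constructor <;> linarith

open MeasureTheory Set in
theorem integral_zero_pos_of_pos {f : ℝ → ℝ} (hpos : ∀ t > (0:ℝ), 0 < f t)
    (hint : ∀ t > (0:ℝ), IntegrableOn f (Ioc 0 t)) {t : ℝ} (ht : 0 < t) :
    0 < ∫ u in (0:ℝ)..t, f u :=
  intervalIntegral.intervalIntegral_pos_of_pos_on
    (intervalIntegrable_of_integrableOn_Ioc_zero hint le_rfl ht.le) (fun u hu => hpos u hu.1) ht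

/-- Iterating a contraction along doublings of the argument. -/
theorem le_pow_mul_of_doubling {f : ℝ → ℝ} {c M T : ℝ} (hc : 0 ≤ c) (hT : 0 < T)
    (hbase : ∀ t, T ≤ t → t ≤ 2 * T → f t ≤ M)
    (hstep : ∀ t, T ≤ t → f (2 * t) ≤ c * f t) (n : ℕ) :
    ∀ t, 2 ^ n * T ≤ t → t ≤ 2 ^ (n + 1) * T → f t ≤ c ^ n * M := by
  induction n with
  | zero => intro t h1 h2; simpa using hbase t (by simpa using h1) (by simpa using h2)
  | succ n ih =>
    intro t h1 h2
    have h1' : 2 ^ n * T ≤ t / 2 := by rw [pow_succ] at h1; linarith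
    have h2' : t / 2 ≤ 2 ^ (n + 1) * T := by rw [pow_succ] at h2; linarith
    have hT' : T ≤ t / 2 := le_trans (le_mul_of_one_le_left hT.le (one_le_pow₀ one_le_two)) h1'
    have h3 := hstep (t / 2) hT'
    rw [mul_div_cancel₀ t two_ne_zero] at h3
    calc f t ≤ c * f (t / 2) := h3
      _ ≤ c * (c ^ n * M) := mul_le_mul_of_nonneg_left (ih _ h1' h2') hc
      _ = c ^ (n + 1) * M := by ring

theorem exists_two_pow_mul_le {T t : ℝ} (hT : 0 < T) (h : T ≤ t) :
    ∃ n : ℕ, 2 ^ n * T ≤ t ∧ t ≤ 2 ^ (n + 1) * T := by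
  obtain ⟨n, h1, h2⟩ := exists_nat_pow_near ((one_le_div hT).2 h) one_lt_two
  exact ⟨n, (le_div_iff₀ hT).1 h1, ((div_lt_iff₀ hT).1 h2).le⟩

open Filter in
theorem tendsto_zero_of_doubling {f : ℝ → ℝ} {c M T : ℝ} (hc : 0 ≤ c) (hc1 : c < 1) (hT : 0 < T)
    (hM : 0 ≤ M) (hpos : ∀ t, 0 < t → 0 ≤ f t) (hbase : ∀ t, T ≤ t → t ≤ 2 * T → f t ≤ M)
    (hstep : ∀ t, T ≤ t → f (2 * t) ≤ c * f t) : Tendsto f atTop (nhds 0) := by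
  rw [Metric.tendsto_atTop]
  intro ε hε
  have hlim : Tendsto (fun n : ℕ => c ^ n * M) atTop (nhds 0) := by
    simpa using (tendsto_pow_atTop_nhds_zero_of_lt_one hc hc1).mul_const M
  obtain ⟨N, hN⟩ := (hlim.eventually (gt_mem_nhds hε)).exists
  refine ⟨2 ^ (N + 1) * T, fun t ht => ?_⟩
  have hTt : T ≤ t := le_trans (le_mul_of_one_le_left hT.le (one_le_pow₀ one_le_two)) ht
  obtain ⟨n, h1, h2⟩ := exists_two_pow_mul_le hT hTt
  have hNn : N ≤ n := by
    have h3 : (2:ℝ) ^ (N + 1) ≤ 2 ^ (n + 1) := le_of_mul_le_mul_right (ht.trans h2) hT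
    have := (pow_le_pow_iff_right₀ one_lt_two).1 h3
    omega
  have h4 : f t ≤ c ^ N * M := (le_pow_mul_of_doubling hc hT hbase hstep n t h1 h2).trans
    (mul_le_mul_of_nonneg_right (pow_le_pow_of_le_one hc hc1.le hNn) hM)
  rw [Real.dist_eq, sub_zero, abs_of_nonneg (hpos t (hT.trans_le hTt))]
  exact h4.trans_lt hN

open Filter MeasureTheory Set in
/-- Half of Karamata's theorem for index `-ρ` with `ρ ≥ 1`. -/
theorem tendsto_mul_div_integral_zero {q : ℝ → ℝ} {ρ : ℝ} (hρ : 1 ≤ ρ)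
    (hpos : ∀ t > (0:ℝ), 0 < q t) (hanti : AntitoneOn q (Ioi 0))
    (hint : ∀ t > (0:ℝ), IntegrableOn q (Ioc 0 t))
    (hrv : Tendsto (fun t => q (2 * t) / q t) atTop (nhds ((2:ℝ) ^ (-ρ)))) :
    Tendsto (fun t => t * q t / ∫ u in (0:ℝ)..t, q u) atTop (nhds 0) := by
  have hQpos : ∀ t > (0:ℝ), 0 < ∫ u in (0:ℝ)..t, q u := fun t ht =>
    integral_zero_pos_of_pos hpos hint ht
  have hle : (2:ℝ) ^ (-ρ) ≤ 1 / 2 := by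
    calc (2:ℝ) ^ (-ρ) ≤ 2 ^ (-1:ℝ) := Real.rpow_le_rpow_of_exponent_le one_le_two (by linarith)
      _ = 1 / 2 := by rw [Real.rpow_neg_one]; norm_num
  have key : ∀ n : ℕ, ∀ᶠ t in atTop, (n:ℝ) * (t * q t) ≤ 4 * ∫ u in (0:ℝ)..t, q u := by
    intro n
    induction n with
    | zero =>
      filter_upwards [eventually_gt_atTop 0] with t ht
      have := hQpos t ht
      simp only [Nat.cast_zero, zero_mul]
      linarith
    | succ n ih =>
      have hlt : (2 * (n:ℝ) - 2) * (2:ℝ) ^ (-ρ) < n := by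
        have h1 : (0:ℝ) < (2:ℝ) ^ (-ρ) := by positivity
        have h2 : (n:ℝ) * (2:ℝ) ^ (-ρ) ≤ n * (1 / 2) := by gcongr
        linarith
      have hev : ∀ᶠ t in atTop, ((n + 1 : ℕ):ℝ) * ((2 * t) * q (2 * t)) ≤
          4 * ∫ u in (0:ℝ)..(2 * t), q u := by
        filter_upwards [ih, (hrv.const_mul (2 * (n:ℝ) - 2)).eventually (gt_mem_nhds hlt), eventually_gt_atTop 0]
          with t h1 h2 ht
        have hb := (hanti.integral_bounds hint ht (by linarith : t ≤ 2 * t)).1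
        rw [← mul_div_assoc, div_lt_iff₀ (hpos t ht)] at h2
        have h3 := mul_lt_mul_of_pos_left h2 ht
        push_cast
        nlinarith
      have := (tendsto_id.atTop_div_const (two_pos (α := ℝ))).eventually hev
      filter_upwards [this] with t ht
      simpa [mul_div_cancel₀ t (two_ne_zero (α := ℝ))] using ht
  rw [Metric.tendsto_atTop']
  intro ε hε
  obtain ⟨n, hn⟩ := exists_nat_gt (4 / ε)
  obtain ⟨T, hT⟩ := eventually_atTop.1 (key n)
  refine ⟨max T 0, fun t ht => ?_⟩
  have ht0 : 0 < t := (le_max_right T 0).trans_lt ht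
  have h1 := hT t ((le_max_left T 0).trans ht.le)
  have htq : 0 < t * q t := mul_pos ht0 (hpos t ht0)
  rw [Real.dist_eq, sub_zero, abs_of_pos (div_pos htq (hQpos t ht0)), div_lt_iff₀ (hQpos t ht0)]
  rw [div_lt_iff₀ hε] at hn
  have h2 := mul_lt_mul_of_pos_right hn htq
  nlinarith [mul_le_mul_of_nonneg_left h1 hε.le]

open Filter MeasureTheory Set in
/-- The integral of a regularly varying function of index `-θ`, `θ < 1`, is `O(t r(t))`. -/
theorem exists_integral_le_mul {r : ℝ → ℝ} {θ : ℝ} (hθ : θ < 1)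
    (hpos : ∀ t > (0:ℝ), 0 < r t) (hanti : AntitoneOn r (Ioi 0))
    (hint : ∀ t > (0:ℝ), IntegrableOn r (Ioc 0 t))
    (hrv : Tendsto (fun t => r (2 * t) / r t) atTop (nhds ((2:ℝ) ^ (-θ)))) :
    ∃ C : ℝ, 0 ≤ C ∧ ∀ᶠ t in atTop, ∫ u in (0:ℝ)..t, r u ≤ C * (t * r t) := by
  have hRpos : ∀ t > (0:ℝ), 0 < ∫ u in (0:ℝ)..t, r u := fun t ht =>
    integral_zero_pos_of_pos hpos hint ht
  have hhalf : (1:ℝ) / 2 < 2 ^ (-θ) := by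
    calc (1:ℝ) / 2 = 2 ^ (-1:ℝ) := by rw [Real.rpow_neg_one]; norm_num
      _ < (2:ℝ) ^ (-θ) := Real.rpow_lt_rpow_of_exponent_lt one_lt_two (by linarith)
  obtain ⟨l, hl, hl'⟩ := exists_between hhalf
  obtain ⟨T₀, hT₀⟩ := eventually_atTop.1 (hrv.eventually (lt_mem_nhds hl'))
  set T := max T₀ 1
  have hT : 0 < T := zero_lt_one.trans_le (le_max_right _ _)
  set D := 1 / (2 * l - 1) with hD
  have hDeq : D * (2 * l - 1) = 1 := one_div_mul_cancel (by linarith)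
  have hDpos : 0 < D := one_div_pos.2 (by linarith)
  set M := (∫ u in (0:ℝ)..(2 * T), r u) / (T * r (2 * T)) with hM
  have h2T : (0:ℝ) < 2 * T := by linarith
  have hMpos : 0 < M := div_pos (hRpos _ h2T) (mul_pos hT (hpos _ h2T))
  have hbase : ∀ t, T ≤ t → t ≤ 2 * T → (∫ u in (0:ℝ)..t, r u) / (t * r t) - D ≤ M := by
    intro t h1 h2
    have ht : 0 < t := hT.trans_le h1
    have hR : ∫ u in (0:ℝ)..t, r u ≤ ∫ u in (0:ℝ)..(2 * T), r u := by
      have := (hanti.integral_bounds hint ht h2).1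
      have := mul_nonneg (sub_nonneg.2 h2) (hpos _ h2T).le
      linarith
    have hr : r (2 * T) ≤ r t := hanti ht h2T h2
    have : (∫ u in (0:ℝ)..t, r u) / (t * r t) ≤ M :=
      div_le_div₀ (hRpos _ h2T).le hR (mul_pos hT (hpos _ h2T))
        (mul_le_mul h1 hr (hpos _ h2T).le ht.le)
    linarith
  have hstep : ∀ t, T ≤ t → (∫ u in (0:ℝ)..(2 * t), r u) / (2 * t * r (2 * t)) - D ≤
      1 / (2 * l) * ((∫ u in (0:ℝ)..t, r u) / (t * r t) - D) := by
    intro t h1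
    have ht : 0 < t := hT.trans_le h1
    have hrt := hpos t ht
    have h2 := hT₀ t ((le_max_left _ _).trans h1)
    rw [lt_div_iff₀ hrt] at h2
    have hb := (hanti.integral_bounds hint ht (by linarith : t ≤ 2 * t)).2
    have hl0 : 0 < l := by linarith
    have h3 : (∫ u in (0:ℝ)..(2 * t), r u) / (2 * t * r (2 * t)) ≤
        ((∫ u in (0:ℝ)..t, r u) + t * r t) / (2 * t * (l * r t)) := by
      refine div_le_div₀ ?_ (by linarith) (by positivity) (by gcongr)
      have := hRpos t ht
      positivity
    have h4 : ((∫ u in (0:ℝ)..t, r u) + t * r t) / (2 * t * (l * r t)) =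
        1 / (2 * l) * ((∫ u in (0:ℝ)..t, r u) / (t * r t) + 1) := by
      field_simp
    have h5 : 1 / (2 * l) * (D + 1) = D := by
      rw [show D + 1 = D * (2 * l) by linarith]
      field_simp
    rw [h4] at h3
    linarith
  refine ⟨D + M, by positivity, ?_⟩
  filter_upwards [eventually_ge_atTop T] with t ht
  have ht0 : 0 < t := hT.trans_le ht
  obtain ⟨n, h1, h2⟩ := exists_two_pow_mul_le hT ht
  have hc : (0:ℝ) ≤ 1 / (2 * l) := by
    have : 0 < l := by linarith
    positivity
  have h3 := le_pow_mul_of_doubling (f := fun t => (∫ u in (0:ℝ)..t, r u) / (t * r t) - D)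
    hc hT hbase hstep n t h1 h2
  have h4 : (1 / (2 * l)) ^ n * M ≤ 1 * M := by
    gcongr
    exact pow_le_one₀ hc ((div_le_one (by linarith)).2 (by linarith))
  rw [← div_le_iff₀ (mul_pos ht0 (hpos t ht0))]
  linarith

open Filter MeasureTheory Set in
theorem convolution_bounds {r q : ℝ → ℝ}
    (hrpos : ∀ t > (0:ℝ), 0 < r t) (hqpos : ∀ t > (0:ℝ), 0 < q t)
    (hranti : AntitoneOn r (Ioi 0)) (hqanti : AntitoneOn q (Ioi 0))
    (hrint : ∀ t > (0:ℝ), IntegrableOn r (Ioc 0 t))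
    (hqint : ∀ t > (0:ℝ), IntegrableOn q (Ioc 0 t)) {t d : ℝ} (ht : 0 < t) (hd : 0 < d)
    (hd1 : d < 1) :
    r t * (∫ u in (0:ℝ)..t, q u) ≤ ∫ u in (0:ℝ)..t, r (t - u) * q u ∧
      ∫ u in (0:ℝ)..t, r (t - u) * q u ≤
        r ((1 - d) * t) * (∫ u in (0:ℝ)..t, q u) + q (d * t) * ∫ u in (0:ℝ)..t, r u := by
  have hdt : 0 < d * t := mul_pos hd ht
  have hdt1 : d * t < t := mul_lt_of_lt_one_left ht hd1
  have hdt' : 0 < (1 - d) * t := mul_pos (by linarith) ht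
  have hqi : ∀ {a b : ℝ}, 0 ≤ a → 0 ≤ b → IntervalIntegrable q volume a b :=
    intervalIntegrable_of_integrableOn_Ioc_zero hqint
  have hri : IntervalIntegrable (fun u => r (t - u)) volume 0 t := by
    have := (intervalIntegrable_of_integrableOn_Ioc_zero hrint le_rfl ht.le).comp_sub_left t
    simpa using this.symm
  have hmeas : ∀ {f : ℝ → ℝ} {a b : ℝ}, IntervalIntegrable f volume a b → a ≤ b →
      AEStronglyMeasurable f (volume.restrict (Ioo a b)) := fun hf hab =>
    (((intervalIntegrable_iff_integrableOn_Ioo_of_le hab).1 hf)).aestronglyMeasurable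
  have hri1 : IntervalIntegrable (fun u => r (t - u)) volume 0 (d * t) :=
    hri.mono_set (by rw [uIcc_of_le hdt.le, uIcc_of_le ht.le]; exact Icc_subset_Icc_right hdt1.le)
  have hri2 : IntervalIntegrable (fun u => r (t - u)) volume (d * t) t :=
    hri.mono_set (by rw [uIcc_of_le hdt1.le, uIcc_of_le ht.le]; exact Icc_subset_Icc_left hdt.le)
  have hb1 : ∀ u ∈ Ioo 0 (d * t), r (t - u) ≤ r ((1 - d) * t) := fun u hu =>
    hranti hdt' (by simp only [mem_Ioi]; linarith [hu.2]) (by linarith [hu.2])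
  have hb2 : ∀ u ∈ Ioo (d * t) t, q u ≤ q (d * t) := fun u hu =>
    hqanti hdt (hdt.trans hu.1) hu.1.le
  have hi1 : IntervalIntegrable (fun u => r (t - u) * q u) volume 0 (d * t) := by
    rw [intervalIntegrable_iff_integrableOn_Ioo_of_le hdt.le]
    refine Integrable.bdd_mul (c := r ((1 - d) * t))
      ((intervalIntegrable_iff_integrableOn_Ioo_of_le hdt.le).1 (hqi le_rfl hdt.le))
      (hmeas hri1 hdt.le) ?_
    filter_upwards [ae_restrict_mem measurableSet_Ioo] with u hu
    rw [Real.norm_eq_abs, abs_of_pos (hrpos _ (by linarith [hu.2]))]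
    exact hb1 u hu
  have hi2 : IntervalIntegrable (fun u => r (t - u) * q u) volume (d * t) t := by
    rw [intervalIntegrable_iff_integrableOn_Ioo_of_le hdt1.le]
    refine Integrable.mul_bdd (c := q (d * t))
      ((intervalIntegrable_iff_integrableOn_Ioo_of_le hdt1.le).1 hri2)
      (hmeas (hqi hdt.le ht.le) hdt1.le) ?_
    filter_upwards [ae_restrict_mem measurableSet_Ioo] with u hu
    rw [Real.norm_eq_abs, abs_of_pos (hqpos _ (hdt.trans hu.1))]
    exact hb2 u hu
  constructor
  · rw [← intervalIntegral.integral_const_mul]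
    refine intervalIntegral.integral_mono_on_of_le_Ioo ht.le ((hqi le_rfl ht.le).const_mul _)
      (hi1.trans hi2) fun u hu => ?_
    exact mul_le_mul_of_nonneg_right
      (hranti (by simp only [mem_Ioi]; linarith [hu.2]) ht (by linarith [hu.1])) (hqpos u hu.1).le
  · rw [← intervalIntegral.integral_add_adjacent_intervals hi1 hi2]
    have hsub : ∫ u in (0:ℝ)..t, r (t - u) = ∫ u in (0:ℝ)..t, r u := by
      simp
    refine add_le_add ?_ ?_
    · calc ∫ u in (0:ℝ)..(d * t), r (t - u) * q u
          ≤ ∫ u in (0:ℝ)..(d * t), r ((1 - d) * t) * q u :=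
            intervalIntegral.integral_mono_on_of_le_Ioo hdt.le hi1
              ((hqi le_rfl hdt.le).const_mul _) fun u hu =>
                mul_le_mul_of_nonneg_right (hb1 u hu) (hqpos u hu.1).le
        _ = r ((1 - d) * t) * ∫ u in (0:ℝ)..(d * t), q u := intervalIntegral.integral_const_mul _ _
        _ ≤ r ((1 - d) * t) * ∫ u in (0:ℝ)..t, q u := by
            refine mul_le_mul_of_nonneg_left ?_ (hrpos _ hdt').le
            have h1 := (hqanti.integral_bounds hqint hdt hdt1.le).1
            have h2 := mul_nonneg (sub_nonneg.2 hdt1.le) (hqpos t ht).le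
            linarith
    · calc ∫ u in (d * t)..t, r (t - u) * q u
          ≤ ∫ u in (d * t)..t, q (d * t) * r (t - u) :=
            intervalIntegral.integral_mono_on_of_le_Ioo hdt1.le hi2 (hri2.const_mul _)
              fun u hu => by
                rw [mul_comm]
                exact mul_le_mul_of_nonneg_right (hb2 u hu) (hrpos _ (by linarith [hu.2])).le
        _ = q (d * t) * ∫ u in (d * t)..t, r (t - u) := intervalIntegral.integral_const_mul _ _
        _ ≤ q (d * t) * ∫ u in (0:ℝ)..t, r u := by
            refine mul_le_mul_of_nonneg_left ?_ (hqpos _ hdt).le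
            rw [← hsub, ← intervalIntegral.integral_add_adjacent_intervals hri1 hri2]
            have : 0 ≤ ∫ u in (0:ℝ)..(d * t), r (t - u) :=
              intervalIntegral.integral_nonneg hdt.le fun u hu =>
                (hrpos _ (by linarith [hu.2])).le
            linarith

open Filter in
theorem tendsto_one_sub_exp_neg_div :
    Tendsto (fun x : ℝ => (1 - Real.exp (-x)) / x) (nhdsWithin 0 {0}ᶜ) (nhds 1) := by
  have h : HasDerivAt (fun x : ℝ => 1 - Real.exp (-x)) 1 0 := by
    have h1 := ((hasDerivAt_neg (0:ℝ)).exp).const_sub 1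
    simpa using h1
  refine (hasDerivAt_iff_tendsto_slope.1 h).congr fun x => ?_
  simp [slope_def_field]


open Filter MeasureTheory Real in
theorem stmt5
    (θ ρ : ℝ) (hθpos : 0 < θ) (hρpos : 0 < ρ)
    (r q : ℝ → ℝ)
    (hrpos : ∀ t > (0:ℝ), 0 < r t) (hqpos : ∀ t > (0:ℝ), 0 < q t)
    (hranti : AntitoneOn r (Set.Ioi 0)) (hqanti : AntitoneOn q (Set.Ioi 0))
    (hrint : ∀ t > (0:ℝ), MeasureTheory.IntegrableOn r (Set.Ioc 0 t))
    (hqint : ∀ t > (0:ℝ), MeasureTheory.IntegrableOn q (Set.Ioc 0 t))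
    (hrrv : ∀ c > (0:ℝ), Filter.Tendsto (fun t => r (c * t) / r t) Filter.atTop (nhds (c ^ (-θ))))
    (hqrv : ∀ c > (0:ℝ), Filter.Tendsto (fun t => q (c * t) / q t) Filter.atTop (nhds (c ^ (-ρ))))
    (R Q I P : ℝ → ℝ)
    (hR : ∀ t, R t = ∫ u in (0:ℝ)..t, r u)
    (hQ : ∀ t, Q t = ∫ u in (0:ℝ)..t, q u)
    (hI : ∀ t, I t = ∫ u in (0:ℝ)..t, r (t - u) * q u)
    (hP : ∀ t, P t = 1 - Real.exp (-(I t)))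
    (hθ : θ < 1) (hρ : 1 ≤ ρ) :
    Filter.Tendsto (fun t => I t / (r t * Q t)) Filter.atTop (nhds 1)
    ∧ Filter.Tendsto I Filter.atTop (nhds 0)
    ∧ Filter.Tendsto (fun t => P t / (r t * Q t)) Filter.atTop (nhds 1) := by
  have hQpos : ∀ t > (0:ℝ), 0 < Q t := fun t ht => by
    rw [hQ]; exact integral_zero_pos_of_pos hqpos hqint ht
  have hrQpos : ∀ t > (0:ℝ), 0 < r t * Q t := fun t ht => mul_pos (hrpos t ht) (hQpos t ht)
  have hbounds : ∀ d > (0:ℝ), d < 1 → ∀ t > (0:ℝ), r t * Q t ≤ I t ∧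
      I t ≤ r ((1 - d) * t) * Q t + q (d * t) * R t := fun d hd hd1 t ht => by
    rw [hQ, hI, hR]
    exact convolution_bounds hrpos hqpos hranti hqanti hrint hqint ht hd hd1
  have hqQ : Tendsto (fun t => t * q t / Q t) atTop (nhds 0) := by
    simpa only [hQ] using
      tendsto_mul_div_integral_zero hρ hqpos hqanti hqint (hqrv 2 two_pos)
  obtain ⟨C, hC, hRC⟩ := exists_integral_le_mul hθ hrpos hranti hrint (hrrv 2 two_pos)
  have hlow : ∀ t > (0:ℝ), r t * Q t ≤ I t := fun t ht =>
    (hbounds (1 / 2) (by norm_num) (by norm_num) t ht).1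
  have hIpos : ∀ t > (0:ℝ), 0 < I t := fun t ht => (hrQpos t ht).trans_le (hlow t ht)
  have hratio : Tendsto (fun t => I t / (r t * Q t)) atTop (nhds 1) := by
    refine tendsto_order.2 ⟨fun a ha => ?_, fun a ha => ?_⟩
    · filter_upwards [eventually_gt_atTop 0] with t ht
      exact ha.trans_le ((one_le_div (hrQpos t ht)).2 (hlow t ht))
    · have hcont : Tendsto (fun d : ℝ => (1 - d) ^ (-θ)) (nhdsWithin 0 (Set.Ioi 0)) (nhds 1) := by
        have h1 : ContinuousAt (fun d : ℝ => (1 - d) ^ (-θ)) 0 :=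
          (continuousAt_const.sub continuousAt_id).rpow_const (Or.inl (by simp))
        have h2 := h1.tendsto
        simp only [sub_zero, Real.one_rpow] at h2
        exact h2.mono_left nhdsWithin_le_nhds
      obtain ⟨d, hda, hd, hd1⟩ := ((hcont.eventually (gt_mem_nhds ha)).and
        (Ioo_mem_nhdsGT (zero_lt_one (α := ℝ)))).exists
      have hlim : Tendsto (fun t => r ((1 - d) * t) / r t +
          q (d * t) / q t * (C * (t * q t / Q t))) atTop (nhds ((1 - d) ^ (-θ))) := by
        simpa using (hrrv (1 - d) (by linarith)).add ((hqrv d hd).mul (hqQ.const_mul C))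
      filter_upwards [hlim.eventually (gt_mem_nhds hda), hRC, eventually_gt_atTop 0]
        with t h1 h2 ht
      refine lt_of_le_of_lt ?_ h1
      have hr := hrpos t ht
      have hq := hqpos t ht
      have hQt := hQpos t ht
      have hqd := hqpos (d * t) (mul_pos hd ht)
      rw [div_le_iff₀ (hrQpos t ht)]
      calc I t ≤ r ((1 - d) * t) * Q t + q (d * t) * R t := (hbounds d hd hd1 t ht).2
        _ ≤ r ((1 - d) * t) * Q t + q (d * t) * (C * (t * r t)) := by
            rw [hR]; gcongr
        _ = _ := by field_simp
  have hrQ : Tendsto (fun t => r t * Q t) atTop (nhds 0) := by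
    have hlt : (2:ℝ) ^ (-θ) < 1 := Real.rpow_lt_one_of_one_lt_of_neg one_lt_two (by linarith)
    obtain ⟨c, hc, hc1⟩ := exists_between hlt
    have hc0 : 0 ≤ c := (Real.rpow_nonneg two_pos.le _).trans hc.le
    have hlim : Tendsto (fun t => r (2 * t) / r t * (1 + t * q t / Q t)) atTop
        (nhds ((2:ℝ) ^ (-θ))) := by
      simpa using (hrrv 2 two_pos).mul (hqQ.const_add 1)
    obtain ⟨T₀, hT₀⟩ := eventually_atTop.1 (hlim.eventually (gt_mem_nhds hc))
    have hT : 0 < max T₀ 1 := zero_lt_one.trans_le (le_max_right _ _)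
    have h2T : 0 < 2 * max T₀ 1 := by linarith
    refine tendsto_zero_of_doubling hc0 hc1 hT
      (mul_pos (hrpos _ hT) (hQpos _ h2T)).le (fun t ht => (hrQpos t ht).le) ?_ ?_
    · intro t h1 h2
      have ht : 0 < t := hT.trans_le h1
      refine mul_le_mul (hranti hT ht h1) ?_ (hQpos t ht).le (hrpos _ hT).le
      have h3 := (hqanti.integral_bounds hqint ht h2).1
      have h4 := mul_nonneg (sub_nonneg.2 h2) (hqpos _ h2T).le
      rw [hQ, hQ]
      linarith
    · intro t h1
      have ht : 0 < t := hT.trans_le h1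
      have h2 := hT₀ t ((le_max_left _ _).trans h1)
      have h3 := (hqanti.integral_bounds hqint ht (by linarith : t ≤ 2 * t)).2
      rw [← hQ, ← hQ] at h3
      have hr := hrpos t ht
      have hQt := hQpos t ht
      calc r (2 * t) * Q (2 * t) ≤ r (2 * t) * (Q t + t * q t) :=
            mul_le_mul_of_nonneg_left (by linarith) (hrpos _ (by linarith)).le
        _ = r (2 * t) / r t * (1 + t * q t / Q t) * (r t * Q t) := by field_simp
        _ ≤ c * (r t * Q t) := mul_le_mul_of_nonneg_right h2.le (hrQpos t ht).le
  have hI0 : Tendsto I atTop (nhds 0) := by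
    have h := hratio.mul hrQ
    rw [one_mul] at h
    refine h.congr' ?_
    filter_upwards [eventually_gt_atTop 0] with t ht
    exact div_mul_cancel₀ _ (hrQpos t ht).ne'
  refine ⟨hratio, hI0, ?_⟩
  have hI0' : Tendsto I atTop (nhdsWithin 0 {0}ᶜ) :=
    tendsto_nhdsWithin_iff.2 ⟨hI0, by
      filter_upwards [eventually_gt_atTop 0] with t ht
      exact (hIpos t ht).ne'⟩
  have h := (tendsto_one_sub_exp_neg_div.comp hI0').mul hratio
  rw [one_mul] at h
  refine h.congr' ?_
  filter_upwards [eventually_gt_atTop 0] with t ht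
  have := (hIpos t ht).ne'
  simp only [Function.comp_apply, hP]
  field_simp
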